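/- Let A ⊆ ℕ be dynamically central piecewise syndetic. Then for every k ∈ ℕ and all polynomials p₁, …, p_k ∈ ℚ[x] with p_i(ℤ) ⊆ ℤ and p_i(0) = 0, there exist x, y ∈ ℕ such that x, y, x + p₁(y), …, x + p_k(y) all belong to A (in particular each x + p_i(y) is a positive integer). -/

import Mathlib

/-- A topological dynamical system: a nonempty compact metric space together with a
continuous self-map. -/
structure MetricDynSystem where
  carrier : Type
  [metric : MetricSpace carrier]
  [cpt : CompactSpace carrier]
  [carrier_nonempty : Nonempty carrier]
  map : carrier → carrier
  continuous_map : Continuous map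

attribute [instance] MetricDynSystem.metric MetricDynSystem.cpt MetricDynSystem.carrier_nonempty

/-- A system is minimal if every point has dense forward orbit `{T^n x : n ∈ ℕ}`. -/
def MetricDynSystem.Minimal (S : MetricDynSystem) : Prop :=
  ∀ x : S.carrier, Dense {y : S.carrier | ∃ n : ℕ, 0 < n ∧ S.map^[n] x = y}

/-- `R(x, U)`: the set of (positive) times at which `x` visits `U`. -/
def RetTimes (S : MetricDynSystem) (x : S.carrier) (U : Set S.carrier) : Set ℕ :=
  {n : ℕ | 0 < n ∧ S.map^[n] x ∈ U}

/-- `A` is dynamically central syndetic: it contains a set of return times `R(x, U)` for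
a minimal system and an open `U` containing `x`. -/
def DynCentralSyndetic (A : Set ℕ) : Prop :=
  ∃ S : MetricDynSystem, S.Minimal ∧
    ∃ (x : S.carrier) (U : Set S.carrier), IsOpen U ∧ x ∈ U ∧ RetTimes S x U ⊆ A

/-- `A` is a set of pointwise recurrence: it intersects every dynamically central
syndetic set. -/
def PointwiseRecurrentDual (A : Set ℕ) : Prop :=
  ∀ B : Set ℕ, DynCentralSyndetic B → (A ∩ B).Nonempty

/-- `A` is dynamically central piecewise syndetic: the intersection of a dynamically
central syndetic set and a set of pointwise recurrence. -/
def DynCentralPiecewiseSyndetic (A : Set ℕ) : Prop :=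
  ∃ B C : Set ℕ, DynCentralSyndetic B ∧ PointwiseRecurrentDual C ∧ A = B ∩ C


section Words

/-- Every letter `true` of the word `l`, placed at offset `a`, sits at a position in `S`. -/
def Fits (S : Set ℕ) (a : ℕ) (l : List Bool) : Prop :=
  ∀ s, l[s]? = some true → a + s ∈ S

theorem fits_append {S : Set ℕ} {a : ℕ} {l₁ l₂ : List Bool} :
    Fits S a (l₁ ++ l₂) ↔ Fits S a l₁ ∧ Fits S (a + l₁.length) l₂ := by
  constructor
  · intro h
    refine ⟨fun s hs => h s ?_, fun s hs => ?_⟩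
    · obtain ⟨hlt, -⟩ := List.getElem?_eq_some_iff.1 hs
      rw [List.getElem?_append_left hlt, hs]
    · have := h (l₁.length + s) (by rw [List.getElem?_append_right (by omega)]; simpa using hs)
      rwa [← add_assoc] at this
  · rintro ⟨h₁, h₂⟩ s hs
    rcases lt_or_ge s l₁.length with hlt | hge
    · rw [List.getElem?_append_left hlt] at hs
      exact h₁ s hs
    · rw [List.getElem?_append_right hge] at hs
      have := h₂ _ hs
      rwa [add_assoc, Nat.add_sub_cancel' hge] at this

theorem Fits.mono {S S' : Set ℕ} (hS : S ⊆ S') {a : ℕ} {l : List Bool} (h : Fits S a l) :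
    Fits S' a l := fun s hs => hS (h s hs)

theorem fits_replicate_false (S : Set ℕ) (a n : ℕ) : Fits S a (List.replicate n false) := by
  intro s hs
  simp [List.getElem?_replicate] at hs

theorem getElem?_eq_of_prefix {w v : List Bool} (h : w <+: v) {n : ℕ} (hn : n < w.length) :
    v[n]? = w[n]? := by
  obtain ⟨t, rfl⟩ := h
  exact List.getElem?_append_left hn

theorem suffix_append_cases {v l₁ l₂ : List Bool} (h : v <:+ l₁ ++ l₂) :
    v <:+ l₂ ∨ ∃ v₁, v₁ <:+ l₁ ∧ v = v₁ ++ l₂ := by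
  obtain ⟨u, hu⟩ := h
  rcases List.append_eq_append_iff.1 hu with ⟨b, rfl, rfl⟩ | ⟨b, rfl, rfl⟩
  · exact Or.inr ⟨b, ⟨u, rfl⟩, rfl⟩
  · exact Or.inl ⟨b, rfl⟩

/-- The word `w` occurs in `v` at a position at most `h`. -/
def OccursWithin (w : List Bool) (h : ℕ) (v : List Bool) : Prop :=
  ∃ x : List Bool, x.length ≤ h ∧ x ++ w <+: v

theorem OccursWithin.mono {w v : List Bool} {h h' : ℕ} (hh : h ≤ h') :
    OccursWithin w h v → OccursWithin w h' v :=
  fun ⟨x, hx, hp⟩ => ⟨x, hx.trans hh, hp⟩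

theorem OccursWithin.append_right {w v : List Bool} {h : ℕ} (u : List Bool) :
    OccursWithin w h v → OccursWithin w h (v ++ u) :=
  fun ⟨x, hx, hp⟩ => ⟨x, hx, hp.trans (List.prefix_append v u)⟩

theorem OccursWithin.append_left {w v : List Bool} {h : ℕ} (u : List Bool) :
    OccursWithin w h v → OccursWithin w (u.length + h) (u ++ v) :=
  fun ⟨x, hx, hp⟩ => ⟨u ++ x, by simpa using hx, by
    rw [List.append_assoc]; exact (List.prefix_append_right_inj u).2 hp⟩

theorem occursWithin_append_of_prefix {w u v : List Bool} {h : ℕ} (hw : w <+: v)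
    (hu : u.length ≤ h) : OccursWithin w h (u ++ v) :=
  ⟨u, hu, (List.prefix_append_right_inj u).2 hw⟩

/-- A word together with a bound for the gaps between the places where it may be inserted. -/
structure Block where
  word : List Bool
  gap : ℕ

/-- `e` occurs at the beginning of `e'` and with bounded gaps in `e'`. -/
def Block.Recurs (e e' : Block) : Prop :=
  e.word <+: e'.word ∧ ∀ v, v <:+ e'.word →
    v.length < e.word.length ∨ OccursWithin e.word (e.gap + 2 * e.word.length) v

theorem Block.recurs_self (e : Block) : e.Recurs e := by
  refine ⟨List.prefix_rfl, fun v hv => ?_⟩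
  rcases lt_or_ge v.length e.word.length with h | h
  · exact Or.inl h
  · obtain rfl := hv.eq_of_length_le h
    exact Or.inr ⟨[], by simp, by simp⟩

/-- The blocks whose words can be inserted syndetically often at positions fitting `S`. -/
structure Block.Admissible (S : Set ℕ) (e : Block) : Prop where
  head : e.word[0]? = some true
  fits : Fits (insert 0 S) 0 e.word
  exists_fits : ∀ t, ∃ k ≤ e.gap, Fits S (t + k) e.word

theorem Block.Admissible.length_pos {S : Set ℕ} {e : Block} (h : e.Admissible S) :
    0 < e.word.length := (List.getElem?_eq_some_iff.1 h.head).1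

/-- `l` is a filler between consecutive blocks which keeps the gaps of `e` bounded. -/
def Block.Fills (e : Block) (l : List Bool) : Prop :=
  (l.length ≤ e.gap + e.word.length ∨ OccursWithin e.word (e.gap + e.word.length) l) ∧
  ∀ v, v <:+ l → v.length ≤ e.gap + 2 * e.word.length ∨
    OccursWithin e.word (e.gap + 2 * e.word.length) v

theorem Block.fills_of_length_le {e : Block} {l : List Bool}
    (h : l.length ≤ e.gap + e.word.length) : e.Fills l :=
  ⟨Or.inl h, fun _ hv => Or.inl (hv.length_le.trans (by omega))⟩

theorem Block.Fills.append {e e' : Block} {l₁ l₂ : List Bool} (h₁ : e.Fills l₁) (h₂ : e.Fills l₂)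
    (h : e.Recurs e') : e.Fills (l₁ ++ (e'.word ++ l₂)) := by
  have hp : e.word <+: e'.word ++ l₂ := h.1.trans (List.prefix_append _ _)
  constructor
  · rcases h₁.1 with h₁ | h₁
    · exact Or.inr (occursWithin_append_of_prefix hp h₁)
    · exact Or.inr (h₁.append_right _)
  · intro v hv
    rcases suffix_append_cases hv with hv | ⟨v₁, hv₁, rfl⟩
    · rcases suffix_append_cases hv with hv | ⟨v₂, hv₂, rfl⟩
      · exact h₂.2 v hv
      · rcases h.2 v₂ hv₂ with hs | ho
        · rcases h₂.1 with h₂ | h₂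
          · left
            rw [List.length_append]; omega
          · exact Or.inr ((h₂.append_left v₂).mono (by omega))
        · exact Or.inr (ho.append_right _)
    · rcases h₁.2 v₁ hv₁ with hs | ho
      · exact Or.inr (occursWithin_append_of_prefix hp hs)
      · exact Or.inr (ho.append_right _)

theorem exists_filling {S : Set ℕ} (L : List Block) (hL : ∀ e ∈ L, e.Admissible S)
    (hR : L.Pairwise fun e' e => e.Recurs e') (n a : ℕ) :
    ∃ l : List Bool, l.length = n ∧ Fits S a l ∧ ∀ e ∈ L, e.Fills l := by
  induction L generalizing n a with
  | nil => exact ⟨List.replicate n false, by simp, fits_replicate_false S a n, by simp⟩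
  | cons e' L ih =>
    have ih := ih (fun e he => hL e (List.mem_cons_of_mem _ he)) hR.of_cons
    have he' := hL e' List.mem_cons_self
    have hrec : ∀ e ∈ e' :: L, e.Recurs e' := by
      intro e he
      rcases List.mem_cons.1 he with rfl | he
      · exact e.recurs_self
      · exact (List.pairwise_cons.1 hR).1 e he
    induction n using Nat.strong_induction_on generalizing a with
    | _ n ihn =>
      obtain ⟨k, hk, hfit⟩ := he'.exists_fits a
      rcases lt_or_ge n (k + e'.word.length) with hn | hn
      · obtain ⟨l, hl, hf, hfill⟩ := ih n a
        refine ⟨l, hl, hf, fun e he => ?_⟩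
        rcases List.mem_cons.1 he with rfl | he
        · exact Block.fills_of_length_le (by omega)
        · exact hfill e he
      · obtain ⟨l₁, hl₁, hf₁, hfill₁⟩ := ih k a
        have hpos := he'.length_pos
        obtain ⟨l₂, hl₂, hf₂, hfill₂⟩ :=
          ihn (n - k - e'.word.length) (by omega) (a + k + e'.word.length)
        refine ⟨l₁ ++ (e'.word ++ l₂), by simp only [List.length_append]; omega, ?_, ?_⟩
        · rw [fits_append, fits_append, hl₁]
          exact ⟨hf₁, hfit, hf₂⟩
        · intro e he
          refine Block.Fills.append ?_ (hfill₂ e he) (hrec e he)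
          rcases List.mem_cons.1 he with rfl | he
          · exact Block.fills_of_length_le (by omega)
          · exact hfill₁ e he

theorem Block.Fills.suffix_flanked {e e' : Block} {f : List Bool} (h : e.Fills f)
    (hr : e.Recurs e') (v : List Bool) (hv : v <:+ e'.word ++ (f ++ e'.word)) :
    v.length < e.word.length ∨ OccursWithin e.word (e.gap + 2 * e.word.length) v := by
  rcases suffix_append_cases hv with hv | ⟨v₁, hv₁, rfl⟩
  · rcases suffix_append_cases hv with hv | ⟨v₂, hv₂, rfl⟩
    · exact hr.2 v hv
    · right
      rcases h.2 v₂ hv₂ with hs | ho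
      · exact occursWithin_append_of_prefix hr.1 hs
      · exact ho.append_right _
  · right
    rcases hr.2 v₁ hv₁ with hs | ho
    · rcases h.1 with h | h
      · rw [← List.append_assoc]
        exact occursWithin_append_of_prefix hr.1 (by rw [List.length_append]; omega)
      · exact ((h.append_right _).append_left v₁).mono (by omega)
    · exact ho.append_right _

/-- The combinatorial criterion: every finite subset of `S` can be translated into `S`
syndetically often, by elements of `S`. -/
def IsIdempotentSyndetic (S : Set ℕ) : Prop :=
  ∀ F : Finset ℕ, (F : Set ℕ) ⊆ S →
    ∃ g : ℕ, ∀ t, ∃ m, t ≤ m ∧ m ≤ t + g ∧ m ∈ S ∧ ∀ f ∈ F, m + f ∈ S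

theorem IsIdempotentSyndetic.exists_admissible {S : Set ℕ} (hS : IsIdempotentSyndetic S)
    {w : List Bool} (hhead : w[0]? = some true) (hw : Fits (insert 0 S) 0 w) :
    ∃ g, Block.Admissible S ⟨w, g⟩ := by
  classical
  obtain ⟨g, hg⟩ := hS ((Finset.range w.length).filter fun s => s ∈ S) (by
    intro s hs
    simpa using (Finset.mem_filter.1 hs).2)
  refine ⟨g, hhead, hw, fun t => ?_⟩
  obtain ⟨m, htm, hmg, hmS, hm⟩ := hg t
  refine ⟨m - t, by simpa using by omega, fun s hs => ?_⟩
  rw [Nat.add_sub_cancel' htm]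
  rcases hw s hs with h | h
  · have : s = 0 := by simpa using h
    simpa [this] using hmS
  · rw [zero_add] at h
    exact hm s (Finset.mem_filter.2
      ⟨Finset.mem_range.2 (List.getElem?_eq_some_iff.1 hs).1, h⟩)

theorem IsIdempotentSyndetic.exists_next_block {S : Set ℕ} (hS : IsIdempotentSyndetic S)
    (L : List Block) (hL : ∀ e ∈ L, e.Admissible S)
    (hR : L.Pairwise fun e' e => e.Recurs e') :
    ∃ e' : Block, e'.Admissible S ∧ ∀ e ∈ L, e.Recurs e' ∧
      e.word.length < e'.word.length := by
  cases L with
  | nil =>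
    obtain ⟨g, hg⟩ := hS.exists_admissible (w := [true]) rfl (by
      intro s hs
      obtain ⟨h, -⟩ := List.getElem?_eq_some_iff.1 hs
      left
      simpa using h)
    exact ⟨_, hg, by simp⟩
  | cons e' L =>
    have he' := hL e' List.mem_cons_self
    have hrec : ∀ e ∈ e' :: L, e.Recurs e' := by
      intro e he
      rcases List.mem_cons.1 he with rfl | he
      · exact e.recurs_self
      · exact (List.pairwise_cons.1 hR).1 e he
    obtain ⟨k, hk, hfit⟩ := he'.exists_fits e'.word.length
    obtain ⟨f, hf, hff, hfill⟩ := exists_filling _ hL hR k e'.word.length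
    have hpos := he'.length_pos
    obtain ⟨g, hg⟩ := hS.exists_admissible (w := e'.word ++ (f ++ e'.word))
      (by rw [List.getElem?_append_left hpos]; exact he'.head)
      (by
        rw [fits_append, fits_append, zero_add, hf]
        exact ⟨he'.fits, hff.mono (Set.subset_insert _ _), hfit.mono (Set.subset_insert _ _)⟩)
    refine ⟨_, hg, fun e he => ⟨⟨(hrec e he).1.trans (List.prefix_append _ _),
      (hfill e he).suffix_flanked (hrec e he)⟩, ?_⟩⟩
    have := (hrec e he).1.length_le
    simp only [List.length_append]
    omega

theorem IsIdempotentSyndetic.exists_block_sequence {S : Set ℕ} (hS : IsIdempotentSyndetic S) :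
    ∃ e : ℕ → Block, (∀ n, (e n).Admissible S) ∧
      ∀ i j, i < j → (e i).Recurs (e j) ∧ (e i).word.length < (e j).word.length := by
  let α := {L : List Block // (∀ e ∈ L, e.Admissible S) ∧
    L.Pairwise fun e' e => e.Recurs e' ∧ e.word.length < e'.word.length}
  have step : ∀ L : α, ∃ e : Block, e.Admissible S ∧ ∀ e₀ ∈ L.1, e₀.Recurs e ∧
      e₀.word.length < e.word.length := fun L =>
    hS.exists_next_block L.1 L.2.1 (L.2.2.imp fun h => h.1)
  choose next hadm hnext using step
  let hist : ℕ → α := fun n => Nat.rec ⟨[], by simp, by simp⟩ (fun _ L => ⟨next L :: L.1, by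
    intro e he
    rcases List.mem_cons.1 he with rfl | he
    · exact hadm L
    · exact L.2.1 e he, List.pairwise_cons.2 ⟨hnext L, L.2.2⟩⟩) n
  have hmem : ∀ i j, i < j → next (hist i) ∈ (hist j).1 := by
    intro i j hij
    induction j, hij using Nat.le_induction with
    | base => exact List.mem_cons_self
    | succ j _ ih => exact List.mem_cons_of_mem _ ih
  exact ⟨fun n => next (hist n), fun n => hadm _, fun i j hij => hnext _ _ (hmem i j hij)⟩

/-- Every finite prefix of `x` reappears in `x` with bounded gaps. -/
def IsRecurrentSequence (x : ℕ → Bool) : Prop :=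
  ∀ N, ∃ H, ∀ t, ∃ o, t ≤ o ∧ o ≤ t + H ∧ ∀ s < N, x (o + s) = x s

theorem IsIdempotentSyndetic.exists_recurrentSequence {S : Set ℕ}
    (hS : IsIdempotentSyndetic S) :
    ∃ x : ℕ → Bool, x 0 = true ∧ (∀ n, 0 < n → x n = true → n ∈ S) ∧ IsRecurrentSequence x := by
  obtain ⟨e, hadm, he⟩ := hS.exists_block_sequence
  have hlen : ∀ n, n < (e n).word.length := by
    intro n
    induction n with
    | zero => exact (hadm 0).length_pos
    | succ n ih => exact lt_of_le_of_lt ih (he n (n + 1) (by omega)).2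
  have hrec : ∀ i j, i ≤ j → (e i).Recurs (e j) := by
    intro i j hij
    rcases hij.eq_or_lt with rfl | hij
    · exact Block.recurs_self _
    · exact (he i j hij).1
  let x : ℕ → Bool := fun n => (e n).word[n]'(hlen n)
  have hx : ∀ k n, n < (e k).word.length → (e k).word[n]? = some (x n) := by
    intro k n hn
    have hself : (e n).word[n]? = some (x n) := List.getElem?_eq_getElem (hlen n)
    rcases le_total k n with h | h
    · rw [← hself]
      exact (getElem?_eq_of_prefix (hrec k n h).1 hn).symm
    · rw [← hself]
      exact getElem?_eq_of_prefix (hrec n k h).1 (hlen n)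
  refine ⟨x, ?_, ?_, ?_⟩
  · have := (hx 0 0 (hlen 0)).symm.trans (hadm 0).head
    simpa using this
  · intro n hn hxn
    have := (hadm n).fits n (by rw [hx n n (hlen n), hxn])
    rw [zero_add] at this
    exact this.resolve_left hn.ne'
  · intro N
    refine ⟨(e N).gap + 2 * (e N).word.length, fun t => ?_⟩
    set k := t + (e N).word.length + N with hk
    have hkl := hlen k
    rcases (hrec N k (by omega)).2 ((e k).word.drop t) (List.drop_suffix _ _) with h | h
    · rw [List.length_drop] at h
      omega
    · obtain ⟨y, hy, z, hz⟩ := h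
      refine ⟨t + y.length, by omega, by omega, fun s hs => ?_⟩
      have hsN : s < (e N).word.length := hs.trans (hlen N)
      have hz' := congrArg (fun l => l[y.length + s]?) hz
      have hzl := congrArg List.length hz
      simp only [List.length_append, List.length_drop] at hzl
      simp only [List.append_assoc, List.getElem?_drop] at hz'
      rw [List.getElem?_append_right (by omega), Nat.add_sub_cancel_left,
        List.getElem?_append_left hsN, hx N s hsN, ← add_assoc, hx k _ (by omega)] at hz'
      simpa using hz'.symm

end Words

section SymbolicDynamics

theorem dynCentralSyndetic_of_metrizable {X : Type} [TopologicalSpace X] [CompactSpace X]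
    [TopologicalSpace.MetrizableSpace X] [Nonempty X] {T : X → X} (hT : Continuous T)
    (hmin : ∀ x, Dense {y | ∃ n : ℕ, 0 < n ∧ T^[n] x = y}) (x : X) {U : Set X} (hU : IsOpen U)
    (hxU : x ∈ U) {A : Set ℕ} (hA : ∀ n, 0 < n → T^[n] x ∈ U → n ∈ A) :
    DynCentralSyndetic A := by
  let _ : MetricSpace X := TopologicalSpace.metrizableSpaceMetric X
  exact ⟨⟨X, T, hT⟩, hmin, x, U, hU, hxU, fun n hn => hA n hn.1 hn.2⟩

/-- The shift by `n` on one-sided binary sequences. -/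
def shiftSeq (n : ℕ) (x : ℕ → Bool) : ℕ → Bool := fun i => x (i + n)

theorem continuous_shiftSeq (n : ℕ) : Continuous (shiftSeq n) :=
  continuous_pi fun i => continuous_apply (i + n)

theorem shiftSeq_shiftSeq (m n : ℕ) (x : ℕ → Bool) :
    shiftSeq m (shiftSeq n x) = shiftSeq (n + m) x := by
  funext i
  simp only [shiftSeq]
  congr 1
  omega

/-- The orbit closure of a binary sequence under the shift. -/
def orbitClosure (x : ℕ → Bool) : Set (ℕ → Bool) := closure (Set.range fun n => shiftSeq n x)

theorem mem_closure_seq_iff {K : Set (ℕ → Bool)} {y : ℕ → Bool} :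
    y ∈ closure K ↔ ∀ N, ∃ z ∈ K, ∀ i < N, z i = y i := by
  rw [(PiNat.isTopologicalBasis_cylinders fun _ : ℕ => Bool).mem_closure_iff]
  constructor
  · intro h N
    obtain ⟨z, hz, hzK⟩ := h _ ⟨y, N, rfl⟩ (PiNat.self_mem_cylinder y N)
    exact ⟨z, hzK, PiNat.mem_cylinder_iff.1 hz⟩
  · rintro h _ ⟨w, N, rfl⟩ hy
    obtain ⟨z, hzK, hz⟩ := h N
    refine ⟨z, PiNat.mem_cylinder_iff.2 fun i hi => ?_, hzK⟩
    rw [hz i hi, PiNat.mem_cylinder_iff.1 hy i hi]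

theorem self_mem_orbitClosure (x : ℕ → Bool) : x ∈ orbitClosure x :=
  subset_closure ⟨0, rfl⟩

theorem shiftSeq_mem_orbitClosure {x z : ℕ → Bool} (hz : z ∈ orbitClosure x) :
    shiftSeq 1 z ∈ orbitClosure x := by
  refine map_mem_closure (continuous_shiftSeq 1) hz ?_
  rintro _ ⟨n, rfl⟩
  exact ⟨n + 1, (shiftSeq_shiftSeq 1 n x).symm⟩

/-- The shift map on an orbit closure. -/
def orbitShift (x : ℕ → Bool) (z : orbitClosure x) : orbitClosure x :=
  ⟨shiftSeq 1 z.1, shiftSeq_mem_orbitClosure z.2⟩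

theorem continuous_orbitShift (x : ℕ → Bool) : Continuous (orbitShift x) :=
  ((continuous_shiftSeq 1).comp continuous_subtype_val).subtype_mk _

theorem orbitShift_iterate (x : ℕ → Bool) (n : ℕ) (z : orbitClosure x) :
    ((orbitShift x)^[n] z).1 = shiftSeq n z.1 := by
  induction n with
  | zero => rfl
  | succ n ih =>
    rw [Function.iterate_succ_apply', ← shiftSeq_shiftSeq, ← ih, orbitShift]

theorem IsRecurrentSequence.dense_orbit {x : ℕ → Bool} (hx : IsRecurrentSequence x)
    (z : orbitClosure x) : Dense {y | ∃ n : ℕ, 0 < n ∧ (orbitShift x)^[n] z = y} := by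
  have key : ∀ N k, ∃ n, 0 < n ∧ ∀ i < N, shiftSeq n z.1 i = shiftSeq k x i := by
    intro N k
    obtain ⟨H, hH⟩ := hx (N + k)
    obtain ⟨_, ⟨n, rfl⟩, hn⟩ := mem_closure_seq_iff.1 z.2 (H + 1 + N + k)
    obtain ⟨o, ho₁, ho₂, ho⟩ := hH (n + 1)
    refine ⟨o - n + k, by omega, fun i hi => ?_⟩
    simp only [shiftSeq] at hn ⊢
    rw [← hn _ (by omega), ← ho (i + k) (by omega)]
    congr 1
    omega
  intro y
  rw [Topology.IsInducing.subtypeVal.closure_eq_preimage_closure_image, Set.mem_preimage,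
    mem_closure_seq_iff]
  intro N
  obtain ⟨_, ⟨k, rfl⟩, hk⟩ := mem_closure_seq_iff.1 y.2 N
  obtain ⟨n, hn, hnk⟩ := key N k
  exact ⟨_, ⟨_, ⟨n, hn, rfl⟩, rfl⟩, fun i hi => by
    rw [orbitShift_iterate, hnk i hi]; exact hk i hi⟩

theorem IsIdempotentSyndetic.dynCentralSyndetic {S : Set ℕ} (hS : IsIdempotentSyndetic S) :
    DynCentralSyndetic S := by
  obtain ⟨x, hx0, hxS, hx⟩ := hS.exists_recurrentSequence
  have : CompactSpace (orbitClosure x) := isCompact_iff_compactSpace.1 isClosed_closure.isCompact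
  have : Nonempty (orbitClosure x) := ⟨⟨x, self_mem_orbitClosure x⟩⟩
  refine dynCentralSyndetic_of_metrizable (continuous_orbitShift x) hx.dense_orbit
    ⟨x, self_mem_orbitClosure x⟩ (U := (fun z => z.1 0) ⁻¹' {true}) ?_ hx0 ?_
  · exact (isOpen_discrete ({true} : Set Bool)).preimage
      ((continuous_apply 0).comp continuous_subtype_val)
  · intro n hn hmem
    refine hxS n hn ?_
    rw [Set.mem_preimage, orbitShift_iterate] at hmem
    simpa [shiftSeq] using hmem

end SymbolicDynamics

section PolynomialVanDerWaerden

open Polynomial Filter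

/-- An ultrafilter on `ℕ` which is idempotent for addition (one inclusion is enough). -/
def IsAddIdempotent (q : Ultrafilter ℕ) : Prop :=
  ∀ D ∈ q, ∀ᶠ m in q, ∀ᶠ n in q, m + n ∈ D

theorem IsAddIdempotent.exists_translation_invariant {q : Ultrafilter ℕ}
    (hq : IsAddIdempotent q) {D : Set ℕ} (hD : D ∈ q) :
    ∃ E ⊆ D, E ∈ q ∧ ∀ m ∈ E, ∀ᶠ n in q, m + n ∈ E := by
  refine ⟨{m | m ∈ D ∧ ∀ᶠ n in q, m + n ∈ D}, fun m hm => hm.1, inter_mem hD (hq D hD), ?_⟩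
  rintro m ⟨-, hm⟩
  have := hq {n | m + n ∈ D} hm
  filter_upwards [hm, this] with n h₁ h₂
  exact ⟨h₁, by simpa only [Set.mem_ofPred_eq, ← add_assoc] using h₂⟩

/-- The leading coefficients of the members of `P` of degree `j`. -/
noncomputable def leadingCoeffs (P : Finset ℚ[X]) (j : ℕ) : Finset ℚ :=
  (P.filter fun p => p.natDegree = j).image fun p => p.coeff j

/-- The number of leading coefficients in each degree. -/
noncomputable def polyWeight (P : Finset ℚ[X]) : ℕ →₀ ℕ :=
  Finsupp.onFinset (P.image natDegree) (fun j => (leadingCoeffs P j).card) (by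
    intro j hj
    obtain ⟨c, hc⟩ := Finset.card_pos.1 (Nat.pos_of_ne_zero hj)
    obtain ⟨p, hp, -⟩ := Finset.mem_image.1 hc
    exact Finset.mem_image.2 ⟨p, (Finset.mem_filter.1 hp).1, (Finset.mem_filter.1 hp).2⟩)

/-- Finite families of polynomials are compared by their weights, high degrees first. -/
def WeightLT (P Q : Finset ℚ[X]) : Prop :=
  Finsupp.Lex (· > ·) (· < ·) (polyWeight P) (polyWeight Q)

theorem wellFounded_weightLT : WellFounded WeightLT :=
  InvImage.wf polyWeight
    (Finsupp.Lex.wellFounded' (fun _ => Nat.not_lt_zero _) Nat.lt_wfRel.wf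
      Nat.lt_wfRel.wf)

/-- The polynomial `x ↦ p (x + h) - p h - p₁ x`. -/
noncomputable def polyDerive (p₁ p : ℚ[X]) (h : ℚ) : ℚ[X] :=
  taylor h p - C (p.eval h) - p₁

theorem eval_polyDerive (p₁ p : ℚ[X]) (h x : ℚ) :
    (polyDerive p₁ p h).eval x = p.eval (x + h) - p.eval h - p₁.eval x := by
  simp [polyDerive, taylor_eval]

theorem coeff_polyDerive {p₁ p : ℚ[X]} (h : ℚ) {j : ℕ} (hj : 0 < j) (hp : p.natDegree ≤ j) :
    (polyDerive p₁ p h).coeff j = p.coeff j - p₁.coeff j := by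
  have : (taylor h p).coeff j = p.coeff j := by
    rcases hp.eq_or_lt with rfl | hlt
    · rw [coeff_taylor_natDegree, leadingCoeff]
    · rw [coeff_eq_zero_of_natDegree_lt hlt,
        coeff_eq_zero_of_natDegree_lt (by rwa [natDegree_taylor])]
  rw [polyDerive, coeff_sub, coeff_sub, this, coeff_C, if_neg hj.ne', sub_zero]

theorem natDegree_polyDerive_le {p₁ p : ℚ[X]} (h : ℚ) (hp : p₁.natDegree ≤ p.natDegree) :
    (polyDerive p₁ p h).natDegree ≤ p.natDegree := by
  refine (natDegree_sub_le _ _).trans (max_le ((natDegree_sub_le _ _).trans (max_le ?_ ?_)) hp)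
  · rw [natDegree_taylor]
  · simp

theorem natDegree_polyDerive_of_lt {p₁ p : ℚ[X]} (h : ℚ) (hp : p₁.natDegree < p.natDegree) :
    (polyDerive p₁ p h).natDegree = p.natDegree := by
  refine le_antisymm (natDegree_polyDerive_le h hp.le) (le_natDegree_of_ne_zero ?_)
  rw [coeff_polyDerive h (by omega) le_rfl, coeff_eq_zero_of_natDegree_lt hp, sub_zero]
  exact leadingCoeff_ne_zero.2 (by rintro rfl; simp at hp)

/-- The derived family used in the induction on weights. -/
noncomputable def derivedFamily (p₁ : ℚ[X]) (P : Finset ℚ[X]) (N : ℕ) : Finset ℚ[X] :=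
  (P ×ˢ Finset.range (N + 1)).image fun z => polyDerive p₁ z.1 z.2

theorem mem_derivedFamily {p₁ q : ℚ[X]} {P : Finset ℚ[X]} {N : ℕ} :
    q ∈ derivedFamily p₁ P N ↔ ∃ p ∈ P, ∃ h : ℕ, h ≤ N ∧ polyDerive p₁ p h = q := by
  simp only [derivedFamily, Finset.mem_image, Finset.mem_product, Finset.mem_range, Prod.exists]
  constructor
  · rintro ⟨p, h, ⟨hp, hh⟩, rfl⟩
    exact ⟨p, hp, h, by omega, rfl⟩
  · rintro ⟨p, hp, h, hh, rfl⟩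
    exact ⟨p, h, ⟨hp, by omega⟩, rfl⟩

theorem weightLT_derivedFamily {P P₀ : Finset ℚ[X]} (hP₀ : P₀ ⊆ P) {p₁ : ℚ[X]} (hp₁ : p₁ ∈ P₀)
    (hdeg : 0 < p₁.natDegree) (hmin : ∀ p ∈ P₀, p₁.natDegree ≤ p.natDegree)
    (hP : ∀ p ∈ P, 0 < p.natDegree → p ∈ P₀) (N : ℕ) :
    WeightLT (derivedFamily p₁ P₀ N) P := by
  rw [WeightLT, Finsupp.lex_def]
  refine ⟨p₁.natDegree, fun j hj => ?_, ?_⟩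
  · change (leadingCoeffs _ j).card = (leadingCoeffs _ j).card
    congr 1
    ext c
    simp only [leadingCoeffs, Finset.mem_image, Finset.mem_filter, mem_derivedFamily]
    constructor
    · rintro ⟨_, ⟨⟨p, hp, h, -, rfl⟩, hd⟩, rfl⟩
      rcases (hmin p hp).lt_or_eq with hlt | heq
      · rw [natDegree_polyDerive_of_lt _ hlt] at hd
        refine ⟨p, ⟨hP₀ hp, hd⟩, ?_⟩
        rw [coeff_polyDerive _ (by omega) hd.le, coeff_eq_zero_of_natDegree_lt hj, sub_zero]
      · have := natDegree_polyDerive_le (h : ℚ) (hmin p hp)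
        omega
    · rintro ⟨p, ⟨hp, hd⟩, rfl⟩
      have hj' : p₁.natDegree < p.natDegree := by omega
      refine ⟨_, ⟨⟨p, hP p hp (by omega), 0, by omega, rfl⟩, ?_⟩, ?_⟩
      · rw [natDegree_polyDerive_of_lt _ hj', hd]
      · rw [coeff_polyDerive _ (by omega) hd.le, coeff_eq_zero_of_natDegree_lt hj, sub_zero]
  · change (leadingCoeffs _ _).card < (leadingCoeffs _ _).card
    set d := p₁.natDegree with hd
    have hmem : p₁.coeff d ∈ leadingCoeffs P d :=
      Finset.mem_image.2 ⟨p₁, Finset.mem_filter.2 ⟨hP₀ hp₁, rfl⟩, rfl⟩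
    refine lt_of_le_of_lt ?_ (Finset.card_erase_lt_of_mem hmem)
    refine Finset.card_le_card_of_injOn (fun c => c + p₁.coeff d) ?_
      (fun a _ b _ hab => add_right_cancel hab)
    intro c hc
    simp only [leadingCoeffs, Finset.mem_coe, Finset.mem_image, Finset.mem_filter,
      mem_derivedFamily] at hc
    obtain ⟨_, ⟨⟨p, hp, h, -, rfl⟩, hpd⟩, rfl⟩ := hc
    have hpd' : p.natDegree = d := by
      rcases (hmin p hp).lt_or_eq with hlt | heq
      · rwa [natDegree_polyDerive_of_lt _ hlt] at hpd
      · exact heq.symm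
    have hne : (polyDerive p₁ p h).coeff d ≠ 0 := by
      rw [← hpd]
      refine leadingCoeff_ne_zero.2 fun h0 => ?_
      rw [h0, natDegree_zero] at hpd
      omega
    rw [coeff_polyDerive _ hdeg hpd'.le] at hne ⊢
    refine Finset.mem_coe.2 (Finset.mem_erase.2 ⟨?_, ?_⟩)
    · simpa [sub_eq_zero] using hne
    · exact Finset.mem_image.2 ⟨p, Finset.mem_filter.2 ⟨hP₀ hp, hpd'⟩, by simp⟩

/-- The finitary polynomial van der Waerden property of the family `P` along `q`. -/
def PolyRamsey (q : Ultrafilter ℕ) (P : Finset ℚ[X]) : Prop :=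
  ∀ (κ : Type) [Finite κ], ∀ D ∈ q, ∃ (W : Finset ℚ) (N : ℕ), ∀ χ : ℚ → κ,
    ∃ a ∈ W, ∃ d ∈ D, d ≤ N ∧ ∀ p ∈ P, χ (a + p.eval (d : ℚ)) = χ a

theorem exists_focused {q : Ultrafilter ℕ} {P : Finset ℚ[X]} {p₁ : ℚ[X]}
    (hP : ∀ p ∈ P, p.eval 0 = 0) (ih : ∀ N, PolyRamsey q (derivedFamily p₁ P N))
    (κ : Type) [Fintype κ] {D : Set ℕ} (hD : D ∈ q) (hDD : ∀ m ∈ D, ∀ᶠ n in q, m + n ∈ D)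
    (s : ℕ) : ∃ (W : Finset ℚ) (N : ℕ), ∀ χ : ℚ → κ,
      (∃ a ∈ W, ∃ d ∈ D, d ≤ N ∧ ∀ p ∈ P, χ (a + p.eval (d : ℚ)) = χ a) ∨
      ∃ a ∈ W, ∃ T : Finset κ, T.card = s ∧ ∀ c ∈ T, ∃ d ∈ D, d ≤ N ∧
        ∀ p ∈ P, χ (a + p.eval (d : ℚ)) = c := by
  classical
  induction s with
  | zero => exact ⟨{0}, 0, fun χ => Or.inr ⟨0, by simp, ∅, rfl, by simp⟩⟩
  | succ s ihs =>
    obtain ⟨W, N, hWN⟩ := ihs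
    let W' : Finset ℚ := W ∪
      (W ×ˢ P ×ˢ Finset.range (N + 1)).image fun z => z.1 + z.2.1.eval (z.2.2 : ℚ)
    have hW : ∀ a ∈ W, a ∈ W' := fun a ha => Finset.mem_union_left _ ha
    have hWp : ∀ a ∈ W, ∀ p ∈ P, ∀ d : ℕ, d ≤ N → a + p.eval (d : ℚ) ∈ W' := fun a ha p hp d hd =>
      Finset.mem_union_right _ (Finset.mem_image.2 ⟨(a, p, d), by
        simpa [ha, hp] using by omega, rfl⟩)
    let D' : Set ℕ := {n | n ∈ D ∧ ∀ m ∈ Set.Iic N, m ∈ D → m + n ∈ D}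
    have hD' : D' ∈ q := by
      refine inter_mem hD ((eventually_all_finite (Set.finite_Iic N)).2 fun m _ => ?_)
      by_cases hm : m ∈ D
      · filter_upwards [hDD m hm] with n hn _ using hn
      · exact Eventually.of_forall fun n h => absurd h hm
    obtain ⟨W₂, N₂, h₂⟩ := ih N (W' → κ) D' hD'
    refine ⟨(W₂ ×ˢ W ×ˢ Finset.range (N₂ + 1)).image
        (fun z => z.1 + z.2.1 - p₁.eval (z.2.2 : ℚ)) ∪
      (W₂ ×ˢ W).image (fun z => z.1 + z.2), N + N₂, fun χ => ?_⟩
    obtain ⟨b, hb, d, ⟨hdD, hdN⟩, hd, hbd⟩ := h₂ fun z w => χ (z + w.1)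
    have hbd' : ∀ p ∈ P, ∀ h : ℕ, h ≤ N → ∀ w ∈ W',
        χ (b + (p.eval ((d : ℚ) + h) - p.eval (h : ℚ) - p₁.eval (d : ℚ)) + w) = χ (b + w) := by
      intro p hp h hh w hw
      have := congrFun (hbd _ (mem_derivedFamily.2 ⟨p, hp, h, hh, rfl⟩)) ⟨w, hw⟩
      rwa [eval_polyDerive] at this
    have mono : ∀ a ∈ W, (∃ e ∈ D, e ≤ N ∧ ∀ p ∈ P, χ (b + (a + p.eval (e : ℚ))) = χ (b + a)) →
        ∃ a ∈ (W₂ ×ˢ W ×ˢ Finset.range (N₂ + 1)).image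
          (fun z => z.1 + z.2.1 - p₁.eval (z.2.2 : ℚ)) ∪
        (W₂ ×ˢ W).image (fun z => z.1 + z.2),
        ∃ d ∈ D, d ≤ N + N₂ ∧ ∀ p ∈ P, χ (a + p.eval (d : ℚ)) = χ a := by
      rintro a ha ⟨e, he, heN, h⟩
      refine ⟨b + a, Finset.mem_union_right _ (Finset.mem_image.2 ⟨(b, a), by simp [hb, ha], rfl⟩),
        e, he, by omega, fun p hp => ?_⟩
      rw [add_assoc]
      exact h p hp
    rcases hWN fun z => χ (b + z) with ⟨a, ha, h⟩ | ⟨a, ha, T, hT, hTc⟩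
    · exact Or.inl (mono a ha h)
    · by_cases hc : χ (b + a) ∈ T
      · exact Or.inl (mono a ha (hTc _ hc))
      · refine Or.inr ⟨b + a - p₁.eval (d : ℚ), Finset.mem_union_left _
          (Finset.mem_image.2 ⟨(b, a, d), by simpa [hb, ha] using by omega, rfl⟩),
          insert (χ (b + a)) T, by rw [Finset.card_insert_of_notMem hc, hT], fun c hcT => ?_⟩
        rcases Finset.mem_insert.1 hcT with rfl | hcT
        · refine ⟨d, hdD, by omega, fun p hp => ?_⟩
          rw [← hbd' p hp 0 (by omega) a (hW a ha)]
          congr 1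
          simp [hP p hp]
          ring
        · obtain ⟨e, he, heN, h⟩ := hTc c hcT
          refine ⟨e + d, hdN e heN he, by omega, fun p hp => ?_⟩
          rw [← h p hp, ← hbd' p hp e heN _ (hWp a ha p hp e heN)]
          congr 1
          push_cast
          rw [add_comm (e : ℚ) d]
          ring

theorem polyRamsey {q : Ultrafilter ℕ} (hq : IsAddIdempotent q) (P : Finset ℚ[X])
    (hP : ∀ p ∈ P, p.eval 0 = 0) : PolyRamsey q P := by
  classical
  induction P using wellFounded_weightLT.induction with
  | _ P ih =>
  intro κ _ D hD
  have := Fintype.ofFinite κ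
  set P₀ := P.filter fun p => p ≠ 0 with hP₀
  suffices ∃ (W : Finset ℚ) (N : ℕ), ∀ χ : ℚ → κ,
      ∃ a ∈ W, ∃ d ∈ D, d ≤ N ∧ ∀ p ∈ P₀, χ (a + p.eval (d : ℚ)) = χ a by
    obtain ⟨W, N, h⟩ := this
    refine ⟨W, N, fun χ => ?_⟩
    obtain ⟨a, ha, d, hd, hdN, h⟩ := h χ
    refine ⟨a, ha, d, hd, hdN, fun p hp => ?_⟩
    rcases eq_or_ne p 0 with rfl | hp0
    · simp
    · exact h p (Finset.mem_filter.2 ⟨hp, hp0⟩)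
  rcases P₀.eq_empty_or_nonempty with he | hne
  · obtain ⟨d, hd⟩ := q.nonempty_of_mem hD
    exact ⟨{0}, d, fun χ => ⟨0, by simp, d, hd, le_rfl, by simp [he]⟩⟩
  · obtain ⟨p₁, hp₁, hmin⟩ := P₀.exists_min_image natDegree hne
    have hdeg : ∀ p ∈ P₀, 0 < p.natDegree := by
      intro p hp
      obtain ⟨hpP, hp0⟩ := Finset.mem_filter.1 hp
      refine Nat.pos_of_ne_zero fun h => hp0 ?_
      have hC := eq_C_of_natDegree_eq_zero h
      have := hP p hpP
      rw [hC, eval_C] at this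
      rw [hC, this, C_0]
    have hP₀' : ∀ p ∈ P₀, p.eval 0 = 0 := fun p hp => hP p (Finset.mem_filter.1 hp).1
    obtain ⟨E, hED, hE, hEE⟩ := hq.exists_translation_invariant hD
    have ih' : ∀ N, PolyRamsey q (derivedFamily p₁ P₀ N) := by
      intro N
      refine ih _ (weightLT_derivedFamily (Finset.filter_subset _ _) hp₁ (hdeg p₁ hp₁) hmin
        (fun p hp h => Finset.mem_filter.2 ⟨hp, by rintro rfl; simp at h⟩) N) ?_
      intro r hr
      obtain ⟨p, hp, h, -, rfl⟩ := mem_derivedFamily.1 hr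
      simp [eval_polyDerive, hP₀' p₁ hp₁]
    obtain ⟨W, N, h⟩ := exists_focused hP₀' ih' κ hE hEE (Fintype.card κ)
    refine ⟨W, N, fun χ => ?_⟩
    rcases h χ with ⟨a, ha, d, hd, h⟩ | ⟨a, ha, T, hT, h⟩
    · exact ⟨a, ha, d, hED hd, h⟩
    · obtain ⟨d, hd, h⟩ := h (χ a) (by
        rw [(Finset.card_eq_iff_eq_univ T).1 hT]
        exact Finset.mem_univ _)
      exact ⟨a, ha, d, hED hd, h⟩

end PolynomialVanDerWaerden

section PiecewiseSyndetic

open Polynomial Filter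

/-- A set of integers is piecewise syndetic if it has bounded gaps in arbitrarily long
intervals. -/
def IsPiecewiseSyndetic (A : Set ℤ) : Prop :=
  ∃ g : ℕ, ∀ N : ℕ, ∃ a : ℤ, ∀ t, a ≤ t → t ≤ a + N → ∃ s ∈ A, t ≤ s ∧ s ≤ t + g

theorem IsPiecewiseSyndetic.mono {A B : Set ℤ} (h : A ⊆ B) :
    IsPiecewiseSyndetic A → IsPiecewiseSyndetic B := by
  rintro ⟨g, hg⟩
  refine ⟨g, fun N => ?_⟩
  obtain ⟨a, ha⟩ := hg N
  refine ⟨a, fun t h₁ h₂ => ?_⟩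
  obtain ⟨s, hs, hst⟩ := ha t h₁ h₂
  exact ⟨s, h hs, hst⟩

theorem IsPiecewiseSyndetic.nonempty {A : Set ℤ} : IsPiecewiseSyndetic A → A.Nonempty := by
  rintro ⟨g, hg⟩
  obtain ⟨a, ha⟩ := hg 0
  obtain ⟨s, hs, -⟩ := ha a le_rfl (by simp)
  exact ⟨s, hs⟩

theorem not_isPiecewiseSyndetic_empty : ¬ IsPiecewiseSyndetic ∅ := fun h =>
  Set.not_nonempty_empty h.nonempty

theorem IsPiecewiseSyndetic.of_union {A B : Set ℤ} (h : IsPiecewiseSyndetic (A ∪ B)) :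
    IsPiecewiseSyndetic A ∨ IsPiecewiseSyndetic B := by
  by_contra! hcon
  obtain ⟨hA, hB⟩ := hcon
  obtain ⟨g, hg⟩ := h
  simp only [IsPiecewiseSyndetic] at hB
  push Not at hB
  obtain ⟨N, hN⟩ := hB g
  refine hA ⟨N + g, fun M => ?_⟩
  obtain ⟨a, ha⟩ := hg (M + N)
  refine ⟨a, fun t h₁ h₂ => ?_⟩
  obtain ⟨u, hu₁, hu₂, hu⟩ := hN t
  obtain ⟨s, hs, hs₁, hs₂⟩ := ha u (by omega) (by push_cast; omega)
  rcases hs with hs | hs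
  · exact ⟨s, hs, by omega, by push_cast; omega⟩
  · have := hu s hs hs₁
    omega

theorem IsPiecewiseSyndetic.exists_of_biUnion {ι : Type*} {A : ι → Set ℤ} (I : Finset ι)
    (h : IsPiecewiseSyndetic (⋃ i ∈ I, A i)) : ∃ i ∈ I, IsPiecewiseSyndetic (A i) := by
  classical
  induction I using Finset.induction_on with
  | empty => simp [not_isPiecewiseSyndetic_empty] at h
  | insert i I _ ih =>
    rw [Finset.set_biUnion_insert] at h
    rcases h.of_union with h | h
    · exact ⟨i, Finset.mem_insert_self _ _, h⟩
    · obtain ⟨j, hj, h⟩ := ih h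
      exact ⟨j, Finset.mem_insert_of_mem hj, h⟩

/-- The polynomial takes integer values at natural numbers. -/
def IsIntegerValued (p : ℚ[X]) : Prop := ∀ n : ℕ, ∃ w : ℤ, p.eval (n : ℚ) = w

/-- The elements `x` of `A` with `x + p d ∈ A` for all `p ∈ P`. -/
def polyReturns (P : Finset ℚ[X]) (A : Set ℤ) (d : ℕ) : Set ℤ :=
  {x | x ∈ A ∧ ∀ p ∈ P, ∃ m ∈ A, (m : ℚ) = x + p.eval (d : ℚ)}

theorem IsPiecewiseSyndetic.eventually_polyReturns {q : Ultrafilter ℕ} (hq : IsAddIdempotent q)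
    {P : Finset ℚ[X]} (hP : ∀ p ∈ P, p.eval 0 = 0) (hint : ∀ p ∈ P, IsIntegerValued p)
    {A : Set ℤ} (hA : IsPiecewiseSyndetic A) :
    ∀ᶠ d in q, IsPiecewiseSyndetic (polyReturns P A d) := by
  classical
  by_contra hcon
  rw [← Ultrafilter.eventually_not] at hcon
  obtain ⟨g, hg⟩ := hA
  obtain ⟨W, N, hWN⟩ := polyRamsey hq P hP (Fin (g + 1)) _ hcon
  have hbound : ∃ K : ℕ, (∀ a ∈ W, |⌊a⌋| ≤ K) ∧
      ∀ a ∈ W, ∀ p ∈ P, ∀ d ≤ N, |⌊a + p.eval (d : ℚ)⌋| ≤ K := by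
    let B : Finset ℚ := W ∪
      (W ×ˢ P ×ˢ Finset.range (N + 1)).image fun z => z.1 + z.2.1.eval (z.2.2 : ℚ)
    refine ⟨B.sup fun b => ⌊b⌋.natAbs, fun a ha => ?_, fun a ha p hp d hd => ?_⟩
    · rw [Int.abs_eq_natAbs]
      exact_mod_cast Finset.le_sup (f := fun b : ℚ => ⌊b⌋.natAbs) (Finset.mem_union_left _ ha)
    · rw [Int.abs_eq_natAbs]
      refine Int.ofNat_le.2 (Finset.le_sup (f := fun b : ℚ => ⌊b⌋.natAbs)
        (Finset.mem_union_right _ (Finset.mem_image.2 ⟨(a, p, d), ?_, rfl⟩)))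
      simpa [ha, hp] using by omega
  obtain ⟨K, hK₁, hK₂⟩ := hbound
  let I := (Finset.range (N + 1)).filter fun d => ¬ IsPiecewiseSyndetic (polyReturns P A d)
  have hPS : IsPiecewiseSyndetic (⋃ d ∈ I, polyReturns P A d) := by
    refine ⟨2 * K + g, fun M => ?_⟩
    obtain ⟨b, hb⟩ := hg (M + 2 * K)
    have hcol : ∀ n : ℤ, ∃ i : Fin (g + 1), b ≤ n → n ≤ b + (M + 2 * K : ℕ) →
        n + (i : ℕ) ∈ A := by
      intro n
      by_cases hn : b ≤ n ∧ n ≤ b + (M + 2 * K : ℕ)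
      · obtain ⟨s, hs, h₁, h₂⟩ := hb n hn.1 hn.2
        refine ⟨⟨(s - n).toNat, by omega⟩, fun _ _ => ?_⟩
        simpa [Int.toNat_of_nonneg (sub_nonneg.2 h₁)] using hs
      · exact ⟨0, fun h₁ h₂ => absurd ⟨h₁, h₂⟩ hn⟩
    choose col hcol using hcol
    refine ⟨b, fun t ht₁ ht₂ => ?_⟩
    obtain ⟨a, ha, d, hd, hdN, h⟩ := hWN fun z => col (⌊z⌋ + t + K)
    have hKa := abs_le.1 (hK₁ a ha)
    refine ⟨⌊a⌋ + t + K + (col (⌊a⌋ + t + K) : ℕ), ?_, by omega, ?_⟩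
    · simp only [Set.mem_iUnion]
      refine ⟨d, Finset.mem_filter.2 ⟨Finset.mem_range.2 (by omega), hd⟩,
        hcol _ (by omega) (by push_cast; omega), fun p hp => ?_⟩
      obtain ⟨w, hw⟩ := hint p hp d
      have hKp := abs_le.1 (hK₂ a ha p hp d hdN)
      have hcp := h p hp
      rw [hw, Int.floor_add_intCast] at hKp hcp
      refine ⟨_, hcol (⌊a⌋ + w + t + K) (by omega) (by push_cast; omega), ?_⟩
      rw [hcp, hw]
      push_cast
      ring
    · have := (col (⌊a⌋ + t + K)).is_lt
      push_cast
      omega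
  obtain ⟨d, hd, h⟩ := hPS.exists_of_biUnion
  exact (Finset.mem_filter.1 hd).2 h

/-- The polynomial `x ↦ p (f + x) - p f`. -/
noncomputable def polyShift (p : ℚ[X]) (f : ℕ) : ℚ[X] := taylor (f : ℚ) p - C (p.eval (f : ℚ))

theorem eval_polyShift (p : ℚ[X]) (f : ℕ) (x : ℚ) :
    (polyShift p f).eval x = p.eval (x + f) - p.eval (f : ℚ) := by
  simp [polyShift, taylor_eval]

theorem IsPiecewiseSyndetic.eventually_polyReturns_add {q : Ultrafilter ℕ}
    (hq : IsAddIdempotent q) {P : Finset ℚ[X]} (hint : ∀ p ∈ P, IsIntegerValued p)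
    {A : Set ℤ} {f : ℕ} (hA : IsPiecewiseSyndetic (polyReturns P A f)) :
    ∀ᶠ d in q, IsPiecewiseSyndetic (polyReturns P A (d + f)) := by
  classical
  have h := hA.eventually_polyReturns hq (P := P.image fun p => polyShift p f) (by
    intro r hr
    obtain ⟨p, -, rfl⟩ := Finset.mem_image.1 hr
    simp [eval_polyShift]) (by
    intro r hr n
    obtain ⟨p, hp, rfl⟩ := Finset.mem_image.1 hr
    obtain ⟨w₁, h₁⟩ := hint p hp (n + f)
    obtain ⟨w₂, h₂⟩ := hint p hp f
    refine ⟨w₁ - w₂, ?_⟩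
    push_cast at h₁ ⊢
    rw [eval_polyShift, h₁, h₂])
  filter_upwards [h] with d hd
  refine hd.mono ?_
  rintro x ⟨hx, hxp⟩
  refine ⟨hx.1, fun p hp => ?_⟩
  obtain ⟨m, hm, hmx⟩ := hxp _ (Finset.mem_image_of_mem _ hp)
  obtain ⟨m', hm', hmm'⟩ := hm.2 p hp
  refine ⟨m', hm', ?_⟩
  rw [hmm', hmx, eval_polyShift]
  push_cast
  ring

end PiecewiseSyndetic

section ReturnTimes

open Filter

variable {S : MetricDynSystem}

theorem MetricDynSystem.Minimal.exists_gap (hS : S.Minimal) (x : S.carrier) {V : Set S.carrier}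
    (hV : IsOpen V) (hne : V.Nonempty) :
    ∃ g : ℕ, ∀ t, ∃ n, t ≤ n ∧ n ≤ t + g ∧ n ∈ RetTimes S x V := by
  have hopen : ∀ n : ℕ, IsOpen (S.map^[n] ⁻¹' V) := fun n =>
    hV.preimage (S.continuous_map.iterate n)
  obtain ⟨I, hI⟩ := isCompact_univ.elim_finite_subcover (fun n : ℕ => S.map^[n + 1] ⁻¹' V)
    (fun n => hopen (n + 1)) (by
      intro z _
      obtain ⟨y, hyV, n, hn, rfl⟩ := (hS z).inter_open_nonempty V hV hne
      exact Set.mem_iUnion.2 ⟨n - 1, by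
        rw [Set.mem_preimage, Nat.sub_add_cancel hn]; exact hyV⟩)
  refine ⟨I.sup id + 1, fun t => ?_⟩
  obtain ⟨n, hn, hmem⟩ := Set.mem_iUnion₂.1 (hI (Set.mem_univ (S.map^[t] x)))
  have hle : n ≤ I.sup id := Finset.le_sup (f := id) hn
  refine ⟨n + 1 + t, by omega, by omega, by omega, ?_⟩
  rw [Function.iterate_add_apply]
  exact hmem

theorem exists_open_shift (x : S.carrier) {U : Set S.carrier} (hU : IsOpen U) (hx : x ∈ U)
    (F : Finset ℕ) (hF : ∀ f ∈ F, f ∈ RetTimes S x U) :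
    ∃ V, IsOpen V ∧ x ∈ V ∧ V ⊆ U ∧
      ∀ n ∈ RetTimes S x V, ∀ f ∈ F, n + f ∈ RetTimes S x U := by
  refine ⟨U ∩ ⋂ f ∈ F, S.map^[f] ⁻¹' U, hU.inter (isOpen_biInter_finset fun f _ =>
    hU.preimage (S.continuous_map.iterate f)), ⟨hx, Set.mem_iInter₂.2 fun f hf => (hF f hf).2⟩,
    Set.inter_subset_left, fun n hn f hf => ⟨by have := hn.1; omega, ?_⟩⟩
  rw [add_comm, Function.iterate_add_apply]
  exact Set.mem_iInter₂.1 hn.2.2 f hf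

/-- A set of natural numbers is thick if it contains arbitrarily long intervals. -/
def IsThick (T : Set ℕ) : Prop := ∀ N, ∃ a, ∀ i ≤ N, a + i ∈ T

theorem MetricDynSystem.Minimal.exists_idempotent (hS : S.Minimal) (x : S.carrier)
    {T : Set ℕ} (hT : IsThick T) : ∃ q : Ultrafilter ℕ, IsAddIdempotent q ∧ T ∈ q ∧
      ∀ V, IsOpen V → x ∈ V → RetTimes S x V ∈ q := by
  classical
  let _ : AddSemigroup (Ultrafilter ℕ) := Ultrafilter.addSemigroup
  let D : {V : Set S.carrier // IsOpen V ∧ x ∈ V} × Finset ℕ → Set ℕ := fun z =>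
    {n | n ∈ RetTimes S x z.1.1 ∧ ∀ e ∈ insert 0 z.2, n + e ∈ T}
  have hne : ∀ z, (D z).Nonempty := by
    rintro ⟨⟨V, hV, hxV⟩, E⟩
    obtain ⟨g, hg⟩ := hS.exists_gap x hV ⟨x, hxV⟩
    obtain ⟨a, ha⟩ := hT (g + (insert 0 E).sup id)
    obtain ⟨n, h₁, h₂, hn⟩ := hg a
    refine ⟨n, hn, fun e he => ?_⟩
    have hle : e ≤ (insert 0 E).sup id := Finset.le_sup (f := id) he
    have := ha (n - a + e) (by omega)
    rwa [← add_assoc, Nat.add_sub_cancel' h₁] at this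
  have hdir : Directed (· ≥ ·) fun z => 𝓟 (D z) := by
    rintro ⟨⟨V, hV, hxV⟩, E⟩ ⟨⟨V', hV', hxV'⟩, E'⟩
    refine ⟨⟨⟨V ∩ V', hV.inter hV', hxV, hxV'⟩, E ∪ E'⟩, ?_, ?_⟩
    · refine principal_mono.2 fun n hn => ⟨⟨hn.1.1, hn.1.2.1⟩, fun e he => hn.2 e ?_⟩
      simp only [Finset.mem_insert, Finset.mem_union] at he ⊢
      tauto
    · refine principal_mono.2 fun n hn => ⟨⟨hn.1.1, hn.1.2.2⟩, fun e he => hn.2 e ?_⟩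
      simp only [Finset.mem_insert, Finset.mem_union] at he ⊢
      tauto
  have : Nonempty ({V : Set S.carrier // IsOpen V ∧ x ∈ V} × Finset ℕ) :=
    ⟨⟨⟨Set.univ, isOpen_univ, trivial⟩, ∅⟩⟩
  have hbot : NeBot (⨅ z, 𝓟 (D z)) := iInf_neBot_of_directed' hdir fun z =>
    principal_neBot_iff.2 (hne z)
  let Q : Set (Ultrafilter ℕ) := {q | ∀ z, D z ∈ q}
  obtain ⟨q, hqQ, hq⟩ := exists_idempotent_in_compact_add_subsemigroup
    (fun r : Ultrafilter ℕ => Ultrafilter.continuous_add_left r) Q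
    ⟨Ultrafilter.of (⨅ z, 𝓟 (D z)), fun z =>
      Ultrafilter.of_le _ (mem_iInf_of_mem z (mem_principal_self _))⟩
    (by
      have : Q = ⋂ z, {q | D z ∈ q} := by ext; simp [Q]
      rw [this]
      exact (isClosed_iInter fun z => ultrafilter_isClosed_basic _).isCompact)
    (by
      intro p hp r hr z
      obtain ⟨⟨V, hV, hxV⟩, E⟩ := z
      refine (Ultrafilter.eventually_add p r fun n => n ∈ D ⟨⟨V, hV, hxV⟩, E⟩).2 ?_
      filter_upwards [hp ⟨⟨V, hV, hxV⟩, E⟩] with m hm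
      obtain ⟨V', hV', hxV', -, h⟩ := exists_open_shift x hV hxV {m} (by simpa using hm.1)
      filter_upwards [hr ⟨⟨V', hV', hxV'⟩, (insert 0 E).image fun e => m + e⟩] with n hn
      refine ⟨by simpa [add_comm] using h n hn.1 m (by simp), fun e he => ?_⟩
      have := hn.2 (m + e) (Finset.mem_insert_of_mem (Finset.mem_image_of_mem _ he))
      rwa [← add_assoc, add_comm n m] at this)
  refine ⟨q, fun E hE => ?_, ?_, fun V hV hx => ?_⟩
  · rw [← hq] at hE
    exact (Ultrafilter.eventually_add q q fun n => n ∈ E).1 hE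
  · filter_upwards [hqQ ⟨⟨Set.univ, isOpen_univ, trivial⟩, ∅⟩] with n hn
    simpa using hn.2 0 (by simp)
  · filter_upwards [hqQ ⟨⟨V, hV, hx⟩, ∅⟩] with n hn using hn.1

theorem isThick_of_not_syndetic {Z : Set ℕ}
    (h : ¬ ∃ g : ℕ, ∀ t, ∃ m, t ≤ m ∧ m ≤ t + g ∧ m ∈ Z) : IsThick Zᶜ := by
  push Not at h
  intro N
  obtain ⟨t, ht⟩ := h N
  exact ⟨t, fun i hi => ht (t + i) (by omega) (by omega)⟩

theorem MetricDynSystem.Minimal.isIdempotentSyndetic_polyReturns (hS : S.Minimal)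
    (x : S.carrier) {U : Set S.carrier} (hU : IsOpen U) (hx : x ∈ U) {P : Finset (Polynomial ℚ)}
    (hP : ∀ p ∈ P, p.eval 0 = 0) (hint : ∀ p ∈ P, IsIntegerValued p) {A : Set ℤ}
    (hA : IsPiecewiseSyndetic A) :
    IsIdempotentSyndetic {n | n ∈ RetTimes S x U ∧ IsPiecewiseSyndetic (polyReturns P A n)} := by
  intro F hF
  by_contra hcon
  obtain ⟨q, hq, hqT, hqV⟩ := hS.exists_idempotent x (isThick_of_not_syndetic hcon)
  obtain ⟨V, hV, hxV, hVU, hshift⟩ := exists_open_shift x hU hx F fun f hf => (hF hf).1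
  have h₁ := hA.eventually_polyReturns hq hP hint
  have h₂ : ∀ᶠ n in q, ∀ f ∈ F, IsPiecewiseSyndetic (polyReturns P A (n + f)) :=
    (eventually_all_finset F).2 fun f hf =>
      IsPiecewiseSyndetic.eventually_polyReturns_add hq hint (hF hf).2
  obtain ⟨n, hnT, hnV, h₁, h₂⟩ := (((eventually_of_mem hqT fun _ h => h).and
    ((eventually_of_mem (hqV V hV hxV) fun _ h => h).and (h₁.and h₂)))).exists
  exact hnT ⟨⟨⟨hnV.1, hVU hnV.2⟩, h₁⟩, fun f hf => ⟨hshift n hnV f hf, h₂ f hf⟩⟩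

theorem MetricDynSystem.Minimal.isIdempotentSyndetic_diff (hS : S.Minimal)
    (x : S.carrier) {U : Set S.carrier} (hU : IsOpen U) (hx : x ∈ U) {A : Set ℕ}
    (hA : ¬ IsPiecewiseSyndetic ((fun n : ℕ => (n : ℤ)) '' A)) :
    IsIdempotentSyndetic (RetTimes S x U \ A) := by
  intro F hF
  obtain ⟨V, hV, hxV, hVU, hshift⟩ := exists_open_shift x hU hx F fun f hf => (hF hf).1
  obtain ⟨g, hg⟩ := hS.exists_gap x hV ⟨x, hxV⟩
  simp only [IsPiecewiseSyndetic] at hA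
  push Not at hA
  obtain ⟨N, hN⟩ := hA (g + F.sup id)
  refine ⟨N + g, fun t => ?_⟩
  obtain ⟨u, hu₁, hu₂, hu⟩ := hN t
  have hfree : ∀ n : ℕ, u ≤ n → (n : ℤ) ≤ u + (g + F.sup id : ℕ) → n ∉ A := fun n h₁ h₂ hn => by
    have := hu n ⟨n, hn, rfl⟩ h₁
    omega
  lift u to ℕ using by omega
  obtain ⟨n, hn₁, hn₂, hn⟩ := hg u
  refine ⟨n, by omega, by omega, ⟨⟨hn.1, hVU hn.2⟩, hfree n (by omega) (by push_cast; omega)⟩,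
    fun f hf => ⟨hshift n hn f hf, hfree _ (by omega) ?_⟩⟩
  have hle : f ≤ F.sup id := Finset.le_sup (f := id) hf
  push_cast
  omega

end ReturnTimes

theorem dcps_contains_brauer_polynomial_configurations
    (A : Set ℕ) (hA : DynCentralPiecewiseSyndetic A)
    (k : ℕ) (P : Fin k → Polynomial ℚ)
    (hint : ∀ i, ∀ z : ℤ, ∃ w : ℤ, (P i).eval (z : ℚ) = (w : ℚ))
    (h0 : ∀ i, (P i).eval 0 = 0) :
    ∃ x y : ℕ, 0 < x ∧ 0 < y ∧ x ∈ A ∧ y ∈ A ∧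
      ∀ i : Fin k, ∃ m : ℕ, 0 < m ∧ m ∈ A ∧ (m : ℚ) = (x : ℚ) + (P i).eval (y : ℚ) := by
  classical
  obtain ⟨B, C, ⟨S, hS, x₀, U, hU, hxU, hUB⟩, hC, rfl⟩ := hA
  let A' : Set ℕ := {n | 0 < n ∧ n ∈ B ∩ C}
  have hPS : IsPiecewiseSyndetic ((fun n : ℕ => (n : ℤ)) '' A') := by
    by_contra hcon
    obtain ⟨n, hnC, hn, hnA⟩ :=
      hC _ (hS.isIdempotentSyndetic_diff x₀ hU hxU hcon).dynCentralSyndetic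
    exact hnA ⟨hn.1, hUB hn, hnC⟩
  obtain ⟨y, hyC, hy, hyPS⟩ := hC _ (hS.isIdempotentSyndetic_polyReturns x₀ hU hxU
    (P := Finset.univ.image P) (by simpa using h0)
    (by
      intro p hp n
      obtain ⟨i, -, rfl⟩ := Finset.mem_image.1 hp
      exact_mod_cast hint i n) hPS).dynCentralSyndetic
  obtain ⟨_, ⟨x, hx, rfl⟩, hxP⟩ := hyPS.nonempty
  refine ⟨x, y, hx.1, hy.1, hx.2, ⟨hUB hy, hyC⟩, fun i => ?_⟩
  obtain ⟨_, ⟨m, hm, rfl⟩, hmx⟩ := hxP (P i) (Finset.mem_image_of_mem _ (Finset.mem_univ i))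
  exact ⟨m, hm.1, hm.2, by exact_mod_cast hmx⟩
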